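/- Let $q$ be a squarefree positive integer, $\chi$ a primitive Dirichlet character modulo $q$, and $h$ an integer with $\gcd(h, q) = 1$. Let $I$ be an interval of length at most $N$. Then for every $\epsilon > 0$, $T = \sum_{n \in I} \chi(n) \overline{\chi(n+h)} \ll_\epsilon \left( \frac{N}{q} + 1 \right) q^{1/2 + \epsilon}$. -/

import Mathlib

open Finset

section WeilHelpers
open Polynomial

lemma stepanov {K : Type*} [Field K] [Fintype K] [DecidableEq K] {p : ℕ} [Fact p.Prime] [CharP K p]
    (μ q0 d e m J A : ℕ) (hq0 : q0 = p ^ μ) (hcard : Fintype.card K = q0 * q0)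
    (hde : q0 = d * e + 1) (hd : 0 < d) (f : K[X]) (hf : f.natDegree = m) (hf0 : f ≠ 0)
    (hm : Nat.Coprime m d) (hA1 : 1 ≤ A)
    (hA : d * A + m * d < q0) (hJ : q0 * A + m * q0 + J < d * J * A) (α : K) (hα : α ≠ 0) :
    #{t : K | f.eval t ^ (e * q0 + e) = α} ≤ A + m * q0 + J * q0 := by
  classical
  have hq0pos : 0 < q0 := by omega
  have hmem : m * (e * (d-1)) ≤ m * q0 := by
    apply Nat.mul_le_mul_left
    have : e * (d-1) ≤ e * d := Nat.mul_le_mul_left _ (Nat.sub_le _ _)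
    nlinarith
  let L : (Fin d × Fin J × Fin A → K) →ₗ[K] K[X] :=
    Fintype.linearCombination K (fun x : Fin d × Fin J × Fin A =>
      (X ^ (q0 * (x.2.2 : ℕ)) * C (α ^ (x.1 : ℕ)) * f ^ (e * (d - 1 - (x.1 : ℕ))) * X ^ (x.2.1 : ℕ) : K[X]))
  have hL : ∀ c, L c ∈ degreeLT K (q0 * A + m * q0 + J) := by
    intro c
    simp only [L, Fintype.linearCombination_apply]
    apply Submodule.sum_mem
    rintro ⟨i, j, k⟩ -
    apply Submodule.smul_mem
    rw [mem_degreeLT]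
    have h1 : (X ^ (q0 * (k : ℕ)) * C (α ^ (i : ℕ)) * f ^ (e * (d - 1 - (i : ℕ))) * X ^ (j : ℕ) : K[X]).natDegree ≤ q0 * k + 0 + (e * (d - 1 - (i : ℕ))) * m + j := by
      refine natDegree_mul_le_of_le (natDegree_mul_le_of_le (natDegree_mul_le_of_le ?_ ?_) ?_) ?_
      · exact natDegree_X_pow_le _
      · simp
      · rw [← hf]; exact natDegree_pow_le
      · exact natDegree_X_pow_le _
    refine lt_of_le_of_lt degree_le_natDegree ?_
    norm_cast
    refine lt_of_le_of_lt h1 ?_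
    have h2 : e * (d - 1 - (i : ℕ)) * m ≤ m * q0 := by
      refine le_trans ?_ hmem
      rw [mul_comm]
      exact Nat.mul_le_mul_left _ (Nat.mul_le_mul_left _ (Nat.sub_le _ _))
    have h3 : q0 * k ≤ q0 * A := Nat.mul_le_mul_left _ k.2.le
    have := j.2
    omega
  let L' := L.codRestrict _ hL
  have hker : LinearMap.ker L' ≠ ⊥ := by
    apply LinearMap.ker_ne_bot_of_finrank_lt
    rw [(degreeLTEquiv K _).finrank_eq]
    simp only [Module.finrank_fintype_fun_eq_card, Fintype.card_prod, Fintype.card_fin]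
    rw [← mul_assoc]; exact hJ
  obtain ⟨c, hc, hc0⟩ := (Submodule.ne_bot_iff _).1 hker
  have hLc : L c = 0 := by
    have : L' c = 0 := hc
    exact congrArg Subtype.val this
  let k : Fin d → Fin J → K[X] := fun i j => ∑ l : Fin A, C (c (i, j, l) ^ q0) * X ^ (l : ℕ)
  let T : Fin d × Fin J → K[X] := fun x => k x.1 x.2 * f ^ (e * (x.1 : ℕ)) * X ^ (q0 * (x.2 : ℕ))
  let S : K[X] := ∑ x, T x
  have hkdeg : ∀ i j, (k i j).natDegree < A := by
    intro i j
    have : (k i j).degree < A := by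
      rw [← mem_degreeLT]
      apply Submodule.sum_mem
      intro l _
      rw [mem_degreeLT]
      exact lt_of_le_of_lt (degree_C_mul_X_pow_le _ _) (by exact_mod_cast l.2)
    by_cases h0 : k i j = 0
    · rw [h0]; simp; omega
    · exact (natDegree_lt_iff_degree_lt h0).2 this
  have hkcoeff : ∀ i j (l : Fin A), (k i j).coeff l = c (i, j, l) ^ q0 := by
    intro i j l
    simp only [k, finsetSum_coeff, coeff_C_mul, coeff_X_pow]
    rw [Finset.sum_eq_single l]
    · simp
    · intro b _ hb
      rw [if_neg (fun h => hb (Fin.ext h.symm))]; simp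
    · simp
  have hTdeg : ∀ x, T x ≠ 0 → (T x).natDegree = (k x.1 x.2).natDegree + e * x.1 * m + q0 * x.2 := by
    intro x hx
    have hk : k x.1 x.2 ≠ 0 := by
      intro h; apply hx; simp [T, h]
    simp only [T]
    rw [natDegree_mul (mul_ne_zero hk (pow_ne_zero _ hf0)) (pow_ne_zero _ X_ne_zero),
      natDegree_mul hk (pow_ne_zero _ hf0), natDegree_pow, natDegree_X_pow, hf]
  have hS0 : S ≠ 0 := by
    have hdeg := degree_sum_eq_of_disjoint T univ (by
      rintro ⟨i, j⟩ ⟨_, hx⟩ ⟨i', j'⟩ ⟨_, hy⟩ hxy heq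
      apply hxy
      simp only [Function.comp_apply] at heq
      have heq := natDegree_eq_of_degree_eq heq
      rw [hTdeg _ hx, hTdeg _ hy] at heq
      simp only at heq
      have b1 := hkdeg i j
      have b2 := hkdeg i' j'
      generalize (k i j).natDegree = a at *
      generalize (k i' j').natDegree = a' at *
      have hi := i.2
      have hi' := i'.2
      have key : (q0 : ℤ) * ((i : ℤ) * m + j * d - (i' * m + j' * d)) = (d * a' - i' * m) - (d * a - i * m) := by
        zify at heq hde
        have : (d : ℤ) * e = q0 - 1 := by linarith
        linear_combination (d : ℤ) * heq - ((i : ℤ) * m - i' * m) * this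
      have hlt : |((d : ℤ) * a' - i' * m) - (d * a - i * m)| < q0 := by
        have e1 : (d : ℤ) * a ≤ d * A := by gcongr
        have e2 : (d : ℤ) * a' ≤ d * A := by gcongr
        have e3 : (i : ℤ) * m ≤ m * d := by rw [mul_comm]; gcongr
        have e4 : (i' : ℤ) * m ≤ m * d := by rw [mul_comm]; gcongr
        have e5 : (0 : ℤ) ≤ d * a := by positivity
        have e6 : (0 : ℤ) ≤ d * a' := by positivity
        have e7 : (0 : ℤ) ≤ i * m := by positivity
        have e8 : (0 : ℤ) ≤ i' * m := by positivity
        zify at hA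
        rw [abs_lt]; constructor <;> linarith
      have hz : ((i : ℤ) * m + j * d - (i' * m + j' * d)) = 0 := by
        rw [← key, abs_mul] at hlt
        by_contra hne
        have : 1 ≤ |((i : ℤ) * m + j * d - (i' * m + j' * d))| := Int.one_le_abs hne
        have h3 : |(q0 : ℤ)| = q0 := abs_of_nonneg (by positivity)
        rw [h3] at hlt
        nlinarith
      have hdvd : (d : ℤ) ∣ ((i : ℤ) - i') * m := ⟨j' - j, by linear_combination hz⟩
      have hdvd' : (d : ℤ) ∣ ((i : ℤ) - i') := by
        refine IsCoprime.dvd_of_dvd_mul_right ?_ hdvd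
        exact (Nat.isCoprime_iff_coprime.2 hm).symm
      have hii : (i : ℤ) - i' = 0 := by
        apply Int.eq_zero_of_abs_lt_dvd hdvd'
        rw [abs_lt]; constructor <;> omega
      have hii' : (i : ℤ) = i' := by linarith
      have hjj : (j : ℤ) = j' := by
        rw [hii'] at hz
        have : (d : ℤ) * (j - j') = 0 := by linear_combination hz
        rcases mul_eq_zero.1 this with h | h
        · omega
        · linarith
      ext
      · exact_mod_cast hii'
      · exact_mod_cast hjj)
    intro hS
    apply hc0
    change degree S = _ at hdeg
    rw [hS, degree_zero] at hdeg
    have hall : ∀ x, T x = 0 := by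
      intro x
      have := (Finset.sup_eq_bot_iff (fun i => (T i).degree) univ).1 hdeg.symm x (mem_univ _)
      exact degree_eq_bot.1 this
    funext ⟨i, j, l⟩
    have h1 := hall (i, j)
    simp only [T] at h1
    have h2 : k i j = 0 := by
      have h3 : f ^ (e * (i : ℕ)) ≠ 0 := pow_ne_zero _ hf0
      have h4 : (X : K[X]) ^ (q0 * (j : ℕ)) ≠ 0 := pow_ne_zero _ X_ne_zero
      simpa [h3, h4] using h1
    have h5 := hkcoeff i j l
    rw [h2, coeff_zero] at h5
    exact (pow_eq_zero_iff hq0pos.ne').1 h5.symm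
  have hSdeg : S.natDegree ≤ A + m * q0 + J * q0 := by
    apply natDegree_sum_le_of_forall_le
    rintro ⟨i, j⟩ -
    by_cases h : T (i, j) = 0
    · rw [h]; simp
    · rw [hTdeg _ h]
      have b1 := hkdeg i j
      have b2 : e * (i : ℕ) * m ≤ m * q0 := by
        refine le_trans ?_ hmem
        rw [mul_comm]
        exact Nat.mul_le_mul_left _ (Nat.mul_le_mul_left _ (by omega))
      have b3 : q0 * (j : ℕ) ≤ J * q0 := by rw [mul_comm]; exact Nat.mul_le_mul_right _ j.2.le
      simp only
      omega
  have hroot : ∀ t : K, f.eval t ^ (e * q0 + e) = α → S.eval t = 0 := by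
    intro t ht
    have hft : f.eval t ≠ 0 := by
      intro h
      rw [h] at ht
      by_cases he : e = 0
      · have hq1 : q0 = 1 := by rw [hde, he]; simp
        have := Fintype.one_lt_card (α := K)
        rw [hcard, hq1] at this; omega
      · rw [zero_pow (by positivity)] at ht
        exact hα ht.symm
    have hq : ∀ y : K, y ^ (q0 * q0) = y := fun y => by rw [← hcard]; exact FiniteField.pow_card y
    have hLt : (L c).eval t = 0 := by rw [hLc]; simp
    have hsum : (S.eval t) ^ q0 * (f.eval t) ^ (e * (d-1)) = (L c).eval t := by
      simp only [S, L, Fintype.linearCombination_apply, eval_finsetSum, T, k, eval_mul, eval_pow, eval_X, eval_C, eval_smul, smul_eq_mul]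
      have hfrob : ∀ {ι : Type} (s : Finset ι) (g : ι → K), (∑ x ∈ s, g x) ^ q0 = ∑ x ∈ s, g x ^ q0 := by
        intro ι s g; rw [hq0]; exact sum_pow_char_pow p μ s g
      rw [hfrob, Finset.sum_mul]
      rw [Fintype.sum_prod_type, Fintype.sum_prod_type]
      refine Finset.sum_congr rfl fun i _ => ?_
      rw [Fintype.sum_prod_type]
      refine Finset.sum_congr rfl fun j _ => ?_
      rw [mul_pow, mul_pow, hfrob, Finset.sum_mul, Finset.sum_mul, Finset.sum_mul]
      refine Finset.sum_congr rfl fun l _ => ?_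
      simp only
      have e1 : (c (i, j, l) ^ q0 * t ^ (l : ℕ)) ^ q0 = c (i, j, l) * t ^ (q0 * l) := by
        rw [mul_pow, ← pow_mul, hq, ← pow_mul, mul_comm q0]
      have e2 : (t ^ (q0 * (j : ℕ))) ^ q0 = t ^ (j : ℕ) := by
        rw [← pow_mul, mul_right_comm, pow_mul, hq]
      have e3 : (f.eval t ^ (e * (i : ℕ))) ^ q0 * f.eval t ^ (e * (d-1)) = α ^ (i : ℕ) * f.eval t ^ (e * (d - 1 - i)) := by
        rw [← ht]
        have : e * (d - 1) = e * (d - 1 - i) + e * i := by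
          rw [← mul_add]; congr 1; have := i.2; omega
        rw [this]
        ring
      rw [e1, e2]
      linear_combination c (i, j, l) * t ^ (q0 * (l : ℕ)) * t ^ (j : ℕ) * e3
    rw [hLt] at hsum
    have := (mul_eq_zero.1 hsum).resolve_right (pow_ne_zero _ hft)
    exact (pow_eq_zero_iff hq0pos.ne').1 this
  calc #{t : K | f.eval t ^ (e * q0 + e) = α} ≤ #S.roots.toFinset := by
        apply Finset.card_le_card
        intro t ht
        simp only [mem_filter, mem_univ, true_and] at ht
        simp [hS0, hroot t ht]
    _ ≤ Multiset.card S.roots := Multiset.toFinset_card_le _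
    _ ≤ S.natDegree := card_roots' _
    _ ≤ _ := hSdeg
lemma charsum_bound (p : ℕ) [Fact p.Prime] (hp : 2 < p) (m : ℕ) (hm : Nat.Coprime m (p-1)) :
    ∃ C : ℝ, ∃ μ0 : ℕ, ∀ μ ≥ μ0, ∀ (K : Type) [Field K] [Fintype K] [Algebra (ZMod p) K],
      Fintype.card K = p ^ μ * p ^ μ → ∀ f : K[X], f.natDegree = m → f ≠ 0 →
      ∀ χ : MulChar (ZMod p) ℂ, χ ≠ 1 →
        ‖∑ t : K, χ (Algebra.norm (ZMod p) (f.eval t))‖ ≤ C * (p : ℝ) ^ μ := by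
  classical
  set d := p - 1 with hd
  have hd2 : 2 ≤ d := by omega
  refine ⟨d * (2 * m + 3) + m, (m + 1 + 2 * m + 2 + (d * m + 2 * d) * m + 1) * d + 1, ?_⟩
  intro μ hμ K _ _ _ hcard f hf hf0 χ hχ
  have : CharP K p := charP_of_injective_algebraMap (algebraMap (ZMod p) K).injective p
  set q0 := p ^ μ with hq0
  obtain ⟨e, he⟩ : d ∣ q0 - 1 := by
    have := Nat.sub_dvd_pow_sub_pow p 1 μ
    simpa using this
  have hq0pos : 0 < q0 := by positivity
  have hde : q0 = d * e + 1 := by omega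
  have hbig : m + 1 + 2 * m + 2 + (d * m + 2 * d) * m + 1 < e := by
    have h1 : μ < q0 := Nat.lt_pow_self (by omega)
    have h2 : (m + 1 + 2 * m + 2 + (d * m + 2 * d) * m + 1) * d < e * d := by
      rw [mul_comm e]; omega
    exact Nat.lt_of_mul_lt_mul_right h2
  set A := e - m with hAdef
  have hAe : e = A + m := by omega
  set J := e + (m + 2) with hJdef
  have hA : d * A + m * d < q0 := by rw [hde, hAe]; nlinarith
  have hJ : q0 * A + m * q0 + J < d * J * A := by
    have h3 : d * J = q0 - 1 + d * (m + 2) := by rw [hJdef, mul_add]; omega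
    have h4 : d * J = q0 + (d * m + 2 * d - 1) := by
      rw [h3, mul_add]; omega
    rw [h4, add_mul]
    have h5 : m * q0 + J < (d * m + 2 * d - 1) * A := by
      have h6 : d * m + 3 ≤ d * m + 2 * d - 1 := by omega
      refine lt_of_lt_of_le ?_ (Nat.mul_le_mul_right A h6)
      rw [hJdef, hde, hAe]
      have h7 : m + 1 + 2 * m + 2 + (d * m + 2 * d) * m + 1 < A + m := by omega
      nlinarith
    omega
  have hcount : ∀ a : ZMod p, a ≠ 0 →
      #{t : K | Algebra.norm (ZMod p) (f.eval t) = a} ≤ e * q0 + (2 * m + 3) * q0 := by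
    intro a ha
    have h1 := stepanov μ q0 d e m J A hq0 hcard hde (by omega) f hf hf0 hm (by omega) hA hJ
      (algebraMap (ZMod p) K a) (by simpa using ha)
    have h2 : A + m * q0 + J * q0 ≤ e * q0 + (2 * m + 3) * q0 := by
      have : A ≤ q0 := by nlinarith
      rw [hJdef]; nlinarith
    refine le_trans (le_of_eq ?_) (h1.trans h2)
    congr 1
    ext t
    simp only [mem_filter, mem_univ, true_and]
    have hn : algebraMap (ZMod p) K (Algebra.norm (ZMod p) (f.eval t)) = f.eval t ^ (e * q0 + e) := by
      rw [FiniteField.algebraMap_norm_eq_pow]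
      congr 1
      rw [Nat.card_eq_fintype_card, Nat.card_eq_fintype_card, hcard, ZMod.card]
      apply Nat.div_eq_of_eq_mul_right (by omega)
      rw [← hd, hde]
      have : (d * e + 1) * (d * e + 1) = d * (e * (d * e + 1) + e) + 1 := by ring
      omega
    rw [← hn]
    exact (algebraMap (ZMod p) K).injective.eq_iff.symm
  set B := e * q0 + (2 * m + 3) * q0 with hB
  let n : ZMod p → ℕ := fun a => #{t : K | Algebra.norm (ZMod p) (f.eval t) = a}
  have hsum : ∑ t : K, χ (Algebra.norm (ZMod p) (f.eval t)) = ∑ a : ZMod p, (n a : ℂ) * χ a := by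
    rw [← Finset.sum_fiberwise (s := univ) (g := fun t : K => Algebra.norm (ZMod p) (f.eval t))]
    refine Finset.sum_congr rfl fun a _ => ?_
    rw [Finset.sum_congr rfl (g := fun _ => χ a), Finset.sum_const, nsmul_eq_mul]
    intro t ht
    simp only [mem_filter, mem_univ, true_and] at ht
    rw [ht]
  have hsum2 : ∑ t : K, χ (Algebra.norm (ZMod p) (f.eval t)) = ∑ a ∈ univ.erase (0 : ZMod p), ((n a : ℂ) - B) * χ a := by
    rw [hsum]
    have h0 : ∑ a : ZMod p, (B : ℂ) * χ a = 0 := by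
      rw [← Finset.mul_sum, MulChar.sum_eq_zero_of_ne_one hχ, mul_zero]
    rw [Finset.sum_erase _ (by rw [MulChar.map_zero, mul_zero]), ← sub_zero (∑ a : ZMod p, (n a : ℂ) * χ a), ← h0,
      ← Finset.sum_sub_distrib]
    simp_rw [sub_mul]
  have htot : ∑ a : ZMod p, n a = q0 * q0 := by
    rw [← hcard, ← Finset.card_univ]
    exact (Finset.card_eq_sum_card_fiberwise (f := fun t : K => Algebra.norm (ZMod p) (f.eval t)) (t := univ) (by simp)).symm
  have hn0 : n 0 ≤ m := by
    rw [← hf]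
    refine le_trans ?_ ((Multiset.toFinset_card_le _).trans (card_roots' f))
    apply Finset.card_le_card
    intro t ht
    simp only [mem_filter, mem_univ, true_and, Algebra.norm_eq_zero_iff] at ht
    simp [hf0, ht]
  have htot2 : q0 * q0 ≤ ∑ a ∈ univ.erase (0 : ZMod p), n a + m := by
    rw [← htot, ← Finset.sum_erase_add _ _ (mem_univ (0 : ZMod p))]
    omega
  rw [hsum2]
  have hcardE : #(univ.erase (0 : ZMod p)) = d := by
    rw [Finset.card_erase_of_mem (mem_univ _), Finset.card_univ, ZMod.card]
  calc ‖∑ a ∈ univ.erase (0 : ZMod p), ((n a : ℂ) - B) * χ a‖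
      ≤ ∑ a ∈ univ.erase (0 : ZMod p), ‖((n a : ℂ) - B) * χ a‖ := norm_sum_le _ _
    _ ≤ ∑ a ∈ univ.erase (0 : ZMod p), ((B : ℝ) - n a) := by
        apply Finset.sum_le_sum
        intro a ha
        have ha0 : a ≠ 0 := (Finset.mem_erase.1 ha).1
        rw [norm_mul]
        have h1 : ‖χ a‖ ≤ 1 := DirichletCharacter.norm_le_one χ a
        have h2 : ‖((n a : ℂ) - B)‖ = (B : ℝ) - n a := by
          have : (n a : ℝ) ≤ B := by exact_mod_cast hcount a ha0
          rw [← norm_neg, neg_sub]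
          rw [show ((B : ℂ) - n a) = (((B : ℝ) - n a : ℝ) : ℂ) by push_cast; ring]
          rw [Complex.norm_real, Real.norm_of_nonneg (by linarith)]
        calc _ ≤ ‖((n a : ℂ) - B)‖ * 1 := by gcongr
          _ = _ := by rw [mul_one, h2]
    _ = d * B - ∑ a ∈ univ.erase (0 : ZMod p), (n a : ℝ) := by
        rw [Finset.sum_sub_distrib, Finset.sum_const, hcardE, nsmul_eq_mul]
    _ ≤ (d * (2 * m + 3) + m) * (q0 : ℝ) := by
        have h1 : (q0 : ℝ) * q0 ≤ ∑ a ∈ univ.erase (0 : ZMod p), (n a : ℝ) + m := by exact_mod_cast htot2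
        have h2 : (q0 : ℝ) = d * e + 1 := by exact_mod_cast hde
        have h3 : (B : ℝ) = e * q0 + (2 * m + 3) * q0 := by exact_mod_cast hB
        have h4 : (1 : ℝ) ≤ q0 := by exact_mod_cast hq0pos
        have h5 : (0 : ℝ) ≤ m := by positivity
        rw [h3]
        have h6 : (q0 : ℝ) * q0 = d * e * q0 + q0 := by nlinarith
        nlinarith
    _ = _ := by rw [hq0]; push_cast; ring
lemma artin_schreier_sum (p : ℕ) [Fact p.Prime] (K : Type) [Field K] [Fintype K]
    [Algebra (ZMod p) K] (G : K → ℂ) :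
    ∑ z : K, G (z ^ p - z) =
      ∑ ψ : AddChar (ZMod p) ℂ, ∑ x : K, G x * ψ (Algebra.trace (ZMod p) K x) := by
  classical
  have : CharP K p := charP_of_injective_algebraMap (algebraMap (ZMod p) K).injective p
  have : ExpChar K p := ExpChar.prime Fact.out
  have hR : ∑ ψ : AddChar (ZMod p) ℂ, ∑ x : K, G x * ψ (Algebra.trace (ZMod p) K x) =
      ∑ x : K, if Algebra.trace (ZMod p) K x = 0 then G x * p else 0 := by
    rw [Finset.sum_comm]
    refine Finset.sum_congr rfl fun x _ => ?_
    rw [← Finset.mul_sum, AddChar.sum_apply_eq_ite]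
    simp
  rw [hR]
  let F : K →+ K := (frobenius K p : K →+ K) - AddMonoidHom.id K
  have hF : ∀ z, F z = z ^ p - z := fun z => rfl
  let Tr : K →+ ZMod p := (Algebra.trace (ZMod p) K).toAddMonoidHom
  have hTr : ∀ x, Tr x = Algebra.trace (ZMod p) K x := fun x => rfl
  have hTrF : ∀ z, Tr (z ^ p) = Tr z := by
    intro z
    rw [hTr, hTr]
    have := Algebra.trace_eq_of_algEquiv (FiniteField.frobeniusAlgEquivOfAlgebraic (ZMod p) K) z
    simpa [ZMod.card] using this
  have hle : F.range ≤ Tr.ker := by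
    rintro _ ⟨z, rfl⟩
    rw [AddMonoidHom.mem_ker, hF, map_sub, hTrF, sub_self]
  have hTrsurj : Function.Surjective Tr := Algebra.trace_surjective (ZMod p) K
  have hc1 : Nat.card Tr.ker * p = Nat.card K := by
    have h1 := AddSubgroup.card_mul_index Tr.ker
    rw [AddSubgroup.index_ker, AddMonoidHom.range_eq_top.2 hTrsurj] at h1
    simpa using h1
  have hc2 : Nat.card F.ker * Nat.card F.range = Nat.card K := by
    have h1 := AddSubgroup.card_mul_index F.ker
    rwa [AddSubgroup.index_ker] at h1
  have hkerset : Nat.card F.ker ≤ p := by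
    have hsub : (F.ker : Set K) ⊆ ((X ^ p - X : K[X]).roots.toFinset : Set K) := by
      intro z hz
      have hz : F z = 0 := hz
      rw [hF] at hz
      have h0 : (X ^ p - X : K[X]) ≠ 0 := FiniteField.X_pow_card_sub_X_ne_zero K (Fact.out : p.Prime).one_lt
      simp [h0, hz]
    have h2 : Nat.card F.ker ≤ #((X ^ p - X : K[X]).roots.toFinset) := by
      have := Set.ncard_le_ncard hsub (Finset.finite_toSet _)
      rwa [Set.ncard_coe_finset] at this
    refine h2.trans ((Multiset.toFinset_card_le _).trans ((card_roots' _).trans ?_))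
    rw [FiniteField.X_pow_card_sub_X_natDegree_eq K (Fact.out : p.Prime).one_lt]
  have hpos : 0 < Nat.card F.range := Nat.card_pos
  have hle2 : Nat.card F.range ≤ Nat.card Tr.ker := AddSubgroup.card_le_of_le hle
  have hkp : Nat.card F.ker = p := by
    apply le_antisymm hkerset
    by_contra hlt
    push Not at hlt
    have : Nat.card F.ker * Nat.card F.range < p * Nat.card Tr.ker :=
      Nat.mul_lt_mul_of_lt_of_le hlt hle2 (lt_of_lt_of_le hpos hle2)
    rw [hc2, mul_comm, hc1] at this
    exact lt_irrefl _ this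
  have heq : F.range = Tr.ker := by
    apply AddSubgroup.eq_of_le_of_card_ge hle
    have : p * Nat.card F.range = p * Nat.card Tr.ker := by
      rw [mul_comm p (Nat.card Tr.ker), hc1, ← hc2, hkp]
    exact (Nat.eq_of_mul_eq_mul_left (Fact.out : p.Prime).pos this).ge
  rw [← Finset.sum_fiberwise (s := univ) (g := fun z : K => z ^ p - z)]
  refine Finset.sum_congr rfl fun x _ => ?_
  rw [Finset.sum_congr rfl (g := fun _ => G x), Finset.sum_const, nsmul_eq_mul]
  swap
  · intro z hz
    simp only [mem_filter, mem_univ, true_and] at hz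
    rw [hz]
  split_ifs with hx
  · have hx' : x ∈ F.range := by rw [heq]; exact hx
    obtain ⟨z0, hz0⟩ := hx'
    have : #{z : K | z ^ p - z = x} = p := by
      have himg : ((({z : K | z ^ p - z = x} : Finset K)) : Set K) = (fun w => w + z0) '' (F.ker : Set K) := by
        ext z
        simp only [coe_filter, mem_univ, true_and, Set.mem_ofPred_eq, Set.mem_image, SetLike.mem_coe, AddMonoidHom.mem_ker]
        constructor
        · intro hz
          refine ⟨z - z0, ?_, by ring⟩
          rw [map_sub, hz0, hF, hz, sub_self]
        · rintro ⟨w, hw, rfl⟩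
          rw [← hF, map_add, hw, hz0, zero_add]
      rw [← Set.ncard_coe_finset, himg, Set.ncard_image_of_injective _ (add_left_injective z0)]
      rw [← SetLike.coe_sort_coe, Nat.card_coe_set_eq] at hkp
      exact hkp
    rw [this, mul_comm]
  · have : ({z : K | z ^ p - z = x} : Finset K) = ∅ := by
      rw [Finset.filter_eq_empty_iff]
      intro z _ hz
      apply hx
      have : x ∈ F.range := ⟨z, by rw [hF, hz]⟩
      rw [heq] at this
      exact this
    rw [this]; simp

lemma sum_psi_bound (p : ℕ) [Fact p.Prime] (hp : 2 < p) (e : ZMod p) (he : e ≠ 0)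
    (χ : MulChar (ZMod p) ℂ) (hχ : χ ≠ 1) :
    ∃ C : ℝ, ∃ μ0 : ℕ, ∀ μ ≥ μ0, ∀ (K : Type) [Field K] [Fintype K] [Algebra (ZMod p) K],
      Fintype.card K = p ^ μ * p ^ μ →
        ‖∑ ψ : AddChar (ZMod p) ℂ, ∑ x : K,
          χ (Algebra.norm (ZMod p) x) * χ⁻¹ (Algebra.norm (ZMod p) (x + algebraMap (ZMod p) K e))
            * ψ (Algebra.trace (ZMod p) K x)‖ ≤ C * (p : ℝ) ^ μ := by
  classical
  obtain ⟨C₀, μ0, hC⟩ := charsum_bound p hp ((p - 1) + (p - 2) * p) (by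
    obtain ⟨d, rfl⟩ : ∃ d, p = d + 2 := ⟨p - 2, by omega⟩
    rw [← Nat.isCoprime_iff_coprime]
    refine ⟨-1, d + 2, ?_⟩
    simp only [Nat.add_sub_cancel, show d + 2 - 1 = d + 1 by omega]
    push_cast
    ring)
  refine ⟨C₀ + 1, μ0, ?_⟩
  intro μ hμ K _ _ _ hcard
  rw [← artin_schreier_sum p K (fun x => χ (Algebra.norm (ZMod p) x) * χ⁻¹ (Algebra.norm (ZMod p) (x + algebraMap (ZMod p) K e)))]
  set E := algebraMap (ZMod p) K e with hE
  have hE0 : E ≠ 0 := by simpa [hE] using he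
  let f1 : K[X] := 1 - X ^ (p-1)
  let f2 : K[X] := 1 - X ^ (p-1) + C E * X ^ p
  have hf1 : f1.natDegree = p - 1 := by
    have : f1 = -(X ^ (p-1) - C 1) := by simp [f1]
    rw [this, natDegree_neg, natDegree_X_pow_sub_C]
  have hf2 : f2.natDegree = p := by
    have h1 : (C E * X ^ p : K[X]).natDegree = p := natDegree_C_mul_X_pow _ _ hE0
    have h2 : f1.natDegree < (C E * X ^ p : K[X]).natDegree := by rw [hf1, h1]; omega
    change (f1 + C E * X ^ p).natDegree = p
    rw [natDegree_add_eq_right_of_natDegree_lt h2, h1]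
  have hf10 : f1 ≠ 0 := by
    intro h; rw [h] at hf1; simp at hf1; omega
  have hf20 : f2 ≠ 0 := by
    intro h; rw [h] at hf2; simp at hf2; omega
  have hfd : (f1 * f2 ^ (p-2)).natDegree = (p - 1) + (p - 2) * p := by
    rw [natDegree_mul hf10 (pow_ne_zero _ hf20), natDegree_pow, hf1, hf2]
  have hmain := hC μ hμ K hcard (f1 * f2 ^ (p-2)) hfd (mul_ne_zero hf10 (pow_ne_zero _ hf20)) χ hχ
  have hinv : ∀ a : ZMod p, χ⁻¹ a = χ (a ^ (p-2)) := by
    intro a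
    rw [MulChar.inv_apply']
    congr 1
    by_cases ha : a = 0
    · rw [ha, inv_zero, zero_pow (by omega)]
    · refine (eq_inv_of_mul_eq_one_left ?_).symm
      rw [← pow_succ, show p - 2 + 1 = p - 1 by omega]
      exact ZMod.pow_card_sub_one_eq_one ha
  let g : K → ℂ := fun z => χ (Algebra.norm (ZMod p) (z ^ p - z)) * χ⁻¹ (Algebra.norm (ZMod p) (z ^ p - z + E))
  have hg : ∀ t : K, t ≠ 0 → g t⁻¹ = χ (Algebra.norm (ZMod p) ((f1 * f2 ^ (p-2)).eval t)) := by
    intro t ht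
    have hpp : t ^ p = t ^ (p - 1) * t := by rw [← pow_succ]; congr 1; omega
    have e1 : t⁻¹ ^ p - t⁻¹ = (t⁻¹) ^ p * f1.eval t := by
      simp only [f1, eval_sub, eval_one, eval_pow, eval_X]
      rw [inv_pow, hpp]; field_simp
    have e2 : t⁻¹ ^ p - t⁻¹ + E = (t⁻¹) ^ p * f2.eval t := by
      simp only [f2, eval_sub, eval_add, eval_mul, eval_C, eval_one, eval_pow, eval_X]
      rw [inv_pow, hpp]; field_simp
    simp only [g]
    rw [e2, e1, map_mul, map_mul (Algebra.norm (ZMod p)) _ (eval t f2), map_mul, map_mul]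
    rw [eval_mul, eval_pow, map_mul, map_mul, map_pow (Algebra.norm (ZMod p)) (eval t f2), ← hinv]
    have hnz : Algebra.norm (ZMod p) (t⁻¹ ^ p) ≠ 0 := by
      rw [Ne, Algebra.norm_eq_zero_iff]; exact pow_ne_zero _ (inv_ne_zero ht)
    have hone : χ (Algebra.norm (ZMod p) (t⁻¹ ^ p)) * χ⁻¹ (Algebra.norm (ZMod p) (t⁻¹ ^ p)) = 1 := by
      rw [MulChar.inv_apply', ← map_mul, mul_inv_cancel₀ hnz, map_one]
    linear_combination χ (Algebra.norm (ZMod p) (eval t f1)) * χ⁻¹ (Algebra.norm (ZMod p) (eval t f2)) * hone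
  have hg0 : g 0 = 0 := by
    simp only [g]
    rw [zero_pow (by omega), sub_zero, Algebra.norm_zero, MulChar.map_zero, zero_mul]
  have hsum : ∑ z : K, g z = ∑ t : K, χ (Algebra.norm (ZMod p) ((f1 * f2 ^ (p-2)).eval t)) - 1 := by
    rw [← Equiv.sum_comp (Equiv.inv K) g]
    rw [← Finset.add_sum_erase _ _ (mem_univ (0 : K)), ← Finset.add_sum_erase (univ) (fun t => χ (Algebra.norm (ZMod p) ((f1 * f2 ^ (p-2)).eval t))) (mem_univ (0 : K))]
    have h0 : χ (Algebra.norm (ZMod p) ((f1 * f2 ^ (p-2)).eval 0)) = 1 := by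
      have : (f1 * f2 ^ (p-2)).eval 0 = 1 := by
        simp only [f1, f2, eval_sub, eval_add, eval_mul, eval_C, eval_one, eval_pow, eval_X]
        rw [zero_pow (by omega), zero_pow (by omega)]; simp
      rw [this, map_one, map_one]
    simp only [Equiv.inv_apply, inv_zero, hg0, h0]
    rw [zero_add, add_sub_cancel_left]
    refine Finset.sum_congr rfl fun t ht => ?_
    exact hg t (Finset.mem_erase.1 ht).1
  change ‖∑ z, g z‖ ≤ _
  rw [hsum]
  refine (norm_sub_le _ _).trans ?_
  have : (1 : ℝ) ≤ (p : ℝ) ^ μ := one_le_pow₀ (by exact_mod_cast (by omega : 1 ≤ p))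
  rw [norm_one]
  linarith
/-- characteristic polynomial of `x` over the prime field, as a power of the minimal polynomial. -/
noncomputable def cpoly (p : ℕ) [Fact p.Prime] (k : ℕ) {K : Type} [Field K]
    [Algebra (ZMod p) K] (x : K) : (ZMod p)[X] :=
  (minpoly (ZMod p) x) ^ (k / (minpoly (ZMod p) x).natDegree)

lemma minpoly_natDegree_dvd (p : ℕ) [Fact p.Prime] (k : ℕ) {K : Type} [Field K] [Fintype K]
    [Algebra (ZMod p) K] (hk : Module.finrank (ZMod p) K = k) (x : K) :
    (minpoly (ZMod p) x).natDegree ∣ k := by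
  rw [← hk]
  exact minpoly.degree_dvd (IsIntegral.of_finite _ x)

lemma cpoly_monic (p : ℕ) [Fact p.Prime] (k : ℕ) {K : Type} [Field K] [Fintype K]
    [Algebra (ZMod p) K] (x : K) : (cpoly p k x).Monic :=
  (minpoly.monic (IsIntegral.of_finite _ x)).pow _

lemma cpoly_natDegree (p : ℕ) [Fact p.Prime] (k : ℕ) {K : Type} [Field K] [Fintype K]
    [Algebra (ZMod p) K] (hk : Module.finrank (ZMod p) K = k) (x : K) :
    (cpoly p k x).natDegree = k := by
  rw [cpoly, (minpoly.monic (IsIntegral.of_finite _ x)).natDegree_pow]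
  exact Nat.div_mul_cancel (minpoly_natDegree_dvd p k hk x)

lemma finrank_over_adjoin (p : ℕ) [Fact p.Prime] (k : ℕ) {K : Type} [Field K] [Fintype K]
    [Algebra (ZMod p) K] (hk : Module.finrank (ZMod p) K = k) (x : K) :
    Module.finrank (IntermediateField.adjoin (ZMod p) {x}) K = k / (minpoly (ZMod p) x).natDegree := by
  have h1 := Module.finrank_mul_finrank (ZMod p) (IntermediateField.adjoin (ZMod p) {x}) K
  rw [IntermediateField.adjoin.finrank (IsIntegral.of_finite _ x), hk] at h1
  rw [← h1, Nat.mul_div_cancel_left]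
  exact minpoly.natDegree_pos (IsIntegral.of_finite _ x)

lemma norm_eq_coeff (p : ℕ) [Fact p.Prime] (k : ℕ) {K : Type} [Field K] [Fintype K]
    [Algebra (ZMod p) K] (hk : Module.finrank (ZMod p) K = k) (x : K) :
    Algebra.norm (ZMod p) x = (-1) ^ k * (cpoly p k x).eval 0 := by
  rw [Algebra.norm_eq_norm_adjoin, finrank_over_adjoin p k hk]
  have h := Algebra.PowerBasis.norm_gen_eq_coeff_zero_minpoly
    (IntermediateField.adjoin.powerBasis (IsIntegral.of_finite (ZMod p) x))
  rw [IntermediateField.adjoin.powerBasis_gen, IntermediateField.adjoin.powerBasis_dim,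
    IntermediateField.minpoly_gen] at h
  rw [h, mul_pow, ← pow_mul, Nat.mul_div_cancel' (minpoly_natDegree_dvd p k hk x), cpoly, eval_pow,
    coeff_zero_eq_eval_zero]

lemma cpoly_add (p : ℕ) [Fact p.Prime] (k : ℕ) {K : Type} [Field K] [Fintype K]
    [Algebra (ZMod p) K] (x : K) (e : ZMod p) :
    (cpoly p k (x + algebraMap (ZMod p) K e)).eval 0 = (cpoly p k x).eval (-e) := by
  have h := minpoly.add_algebraMap x e
  rw [cpoly, cpoly, h, natDegree_comp, natDegree_X_sub_C, mul_one, eval_pow, eval_pow, eval_comp]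
  simp

lemma trace_eq_nextCoeff (p : ℕ) [Fact p.Prime] (k : ℕ) {K : Type} [Field K] [Fintype K]
    [Algebra (ZMod p) K] (hk : Module.finrank (ZMod p) K = k) (x : K) :
    Algebra.trace (ZMod p) K x = - (cpoly p k x).nextCoeff := by
  rw [trace_eq_finrank_mul_minpoly_nextCoeff, finrank_over_adjoin p k hk, cpoly,
    (minpoly.monic (IsIntegral.of_finite _ x)).nextCoeff_pow]
  simp

lemma card_minpoly_eq (p : ℕ) [Fact p.Prime] (k : ℕ) {K : Type} [Field K] [Fintype K]
    [Algebra (ZMod p) K] (hk : Module.finrank (ZMod p) K = k) (P : (ZMod p)[X]) (hP : P.Monic)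
    (hirr : Irreducible P) [DecidableEq (ZMod p)[X]] :
    #{x : K | minpoly (ZMod p) x = P} = if P.natDegree ∣ k then P.natDegree else 0 := by
  classical
  have : CharP K p := charP_of_injective_algebraMap (algebraMap (ZMod p) K).injective p
  have hiff : ∀ x : K, minpoly (ZMod p) x = P ↔ x ∈ P.rootSet K := by
    intro x
    rw [mem_rootSet]
    constructor
    · rintro rfl
      exact ⟨hP.ne_zero, minpoly.aeval _ _⟩
    · rintro ⟨_, h⟩
      exact (minpoly.eq_of_irreducible_of_monic hirr h hP).symm
  split_ifs with hdvd
  · have hdiv := (hirr.natDegree_dvd_iff_dvd_X_pow_card_pow_sub_X).1 hdvd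
    have hcard : Fintype.card K = p ^ k := by
      rw [Module.card_eq_pow_finrank (K := ZMod p), ZMod.card, hk]
    have hsplit : (P.map (algebraMap (ZMod p) K)).Splits := by
      have hd := Polynomial.map_dvd (algebraMap (ZMod p) K) hdiv
      refine Splits.of_dvd ?_ ?_ hd
      · rw [Polynomial.map_sub, Polynomial.map_pow, map_X]
        rw [Nat.card_eq_fintype_card, ZMod.card, ← hcard]
        have := FiniteField.splits_X_pow_card_sub_X (K := K) p
        simpa using this
      · rw [Polynomial.map_sub, Polynomial.map_pow, map_X]
        rw [Nat.card_eq_fintype_card, ZMod.card, ← hcard]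
        exact FiniteField.X_pow_card_sub_X_ne_zero K Fintype.one_lt_card
    have hsep : P.Separable := PerfectField.separable_of_irreducible hirr
    rw [← card_rootSet_eq_natDegree hsep hsplit, Fintype.card_subtype]
    congr 1
    ext x
    simp [hiff]
  · rw [Finset.card_eq_zero, Finset.filter_eq_empty_iff]
    rintro x - rfl
    exact hdvd (minpoly_natDegree_dvd p k hk x)

open UniqueFactorizationMonoid in
lemma count_dvd (p : ℕ) [Fact p.Prime] (K : ℕ → Type) [∀ k, Field (K k)] [∀ k, Fintype (K k)]
    [∀ k, Algebra (ZMod p) (K k)] (hk : ∀ k ≠ 0, Module.finrank (ZMod p) (K k) = k)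
    (n : ℕ) (G : (ZMod p)[X]) (hG : G.Monic) (hn : G.natDegree = n)
    [∀ (k : ℕ) (x : K k), Decidable (cpoly p k x ∣ G)] :
    ∑ k ∈ Icc 1 n, #{x : K k | cpoly p k x ∣ G} = n := by
  classical
  set S := (normalizedFactors G).toFinset with hS
  have hG0 := hG.ne_zero
  have hSirr : ∀ P ∈ S, Irreducible P := fun P hP =>
    irreducible_of_normalized_factor P (Multiset.mem_toFinset.1 hP)
  have hSmon : ∀ P ∈ S, P.Monic := by
    intro P hP
    have h1 := normalize_normalized_factor P (Multiset.mem_toFinset.1 hP)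
    rw [← h1]
    exact monic_normalize (hSirr P hP).ne_zero
  have hprod : (normalizedFactors G).prod = G := by
    have := leadingCoeff_mul_prod_normalizedFactors G
    rwa [hG.leadingCoeff, C_1, one_mul] at this
  have hdeg : ∑ P ∈ S, (normalizedFactors G).count P * P.natDegree = n := by
    rw [← hn]
    conv_rhs => rw [← hprod]
    rw [natDegree_multiset_prod_of_monic _ (fun P hP => hSmon P (Multiset.mem_toFinset.2 hP))]
    rw [Finset.sum_multiset_map_count]
    simp [hS]
  have hpow : ∀ P ∈ S, ∀ j, P ^ j ∣ G ↔ j ≤ (normalizedFactors G).count P := by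
    intro P hP j
    rw [pow_dvd_iff_le_emultiplicity, emultiplicity_eq_count_normalizedFactors (hSirr P hP) hG0,
      (hSmon P hP).normalize_eq_self]
    norm_cast
  have step : ∀ k ∈ Icc 1 n, #{x : K k | cpoly p k x ∣ G} =
      ∑ P ∈ S, if P.natDegree ∣ k ∧ k / P.natDegree ≤ (normalizedFactors G).count P then P.natDegree else 0 := by
    intro k hkm
    have hk1 : 1 ≤ k := (Finset.mem_Icc.1 hkm).1
    rw [Finset.card_eq_sum_card_fiberwise (f := fun x : K k => minpoly (ZMod p) x) (t := S)]
    · refine Finset.sum_congr rfl fun P hP => ?_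
      by_cases hc : P.natDegree ∣ k ∧ k / P.natDegree ≤ (normalizedFactors G).count P
      · rw [if_pos hc]
        have := card_minpoly_eq p k (hk k (by omega)) P (hSmon P hP) (hSirr P hP)
        rw [if_pos hc.1] at this
        rw [← this, Finset.filter_filter]
        congr 1
        ext x
        simp only [mem_filter, mem_univ, true_and, and_iff_right_iff_imp]
        intro hx
        rw [cpoly, hx, hpow P hP]
        exact hc.2
      · rw [if_neg hc, Finset.card_eq_zero, Finset.filter_filter, Finset.filter_eq_empty_iff]
        rintro x - ⟨h1, h2⟩
        apply hc
        rw [cpoly, h2, hpow P hP] at h1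
        refine ⟨?_, h1⟩
        rw [← h2]
        exact minpoly_natDegree_dvd p k (hk k (by omega)) x
    · intro x hx
      simp only [coe_filter, mem_univ, true_and, Set.mem_ofPred_eq] at hx
      have hirr : Irreducible (minpoly (ZMod p) x) := minpoly.irreducible (IsIntegral.of_finite _ x)
      have hmon : (minpoly (ZMod p) x).Monic := minpoly.monic (IsIntegral.of_finite _ x)
      have hd : minpoly (ZMod p) x ∣ G := by
        refine dvd_trans (dvd_pow_self _ ?_) hx
        have h1 := minpoly_natDegree_dvd p k (hk k (by omega)) x
        have := Nat.div_pos (Nat.le_of_dvd hk1 h1) (hirr.natDegree_pos)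
        omega
      rw [hS]
      obtain ⟨Q, hQ, hass⟩ := exists_mem_normalizedFactors_of_dvd hG0 hirr hd
      have : minpoly (ZMod p) x = Q := eq_of_monic_of_associated hmon (hSmon Q (Multiset.mem_toFinset.2 hQ)) hass
      change minpoly (ZMod p) x ∈ (normalizedFactors G).toFinset
      rw [this]; exact Multiset.mem_toFinset.2 hQ
  rw [Finset.sum_congr rfl step, Finset.sum_comm, ← hdeg]
  refine Finset.sum_congr rfl fun P hP => ?_
  rw [hdeg, ← Finset.sum_filter, Finset.sum_const, smul_eq_mul]
  congr 1
  have hdpos := (hSirr P hP).natDegree_pos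
  refine Eq.trans ?_ (show #(Icc 1 ((normalizedFactors G).count P)) = (normalizedFactors G).count P by simp)
  have hle : (normalizedFactors G).count P * P.natDegree ≤ n := by
    rw [← hdeg]
    exact Finset.single_le_sum (f := fun P => (normalizedFactors G).count P * P.natDegree) (fun _ _ => Nat.zero_le _) hP
  symm
  apply Finset.card_bij (fun j _ => j * P.natDegree)
  · intro j hj
    simp only [mem_Icc, mem_filter] at hj ⊢
    refine ⟨⟨Nat.mul_pos hj.1 hdpos, le_trans (Nat.mul_le_mul_right _ hj.2) hle⟩, dvd_mul_left _ _, ?_⟩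
    rw [Nat.mul_div_cancel _ hdpos]; exact hj.2
  · intro a _ b _ hab
    exact Nat.eq_of_mul_eq_mul_right hdpos hab
  · intro k hkk
    simp only [mem_Icc, mem_filter] at hkk
    refine ⟨k / P.natDegree, ?_, Nat.div_mul_cancel hkk.2.1⟩
    rw [mem_Icc]
    exact ⟨Nat.div_pos (Nat.le_of_dvd hkk.1.1 hkk.2.1) hdpos, hkk.2.2⟩
lemma monic_finite (p : ℕ) [Fact p.Prime] (n : ℕ) :
    {g : (ZMod p)[X] | g.Monic ∧ g.natDegree = n}.Finite := by
  have : Finite (degreeLT (ZMod p) (n+1)) :=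
    Finite.of_equiv _ (degreeLTEquiv (ZMod p) (n+1)).symm.toEquiv
  refine Set.Finite.subset (Set.toFinite (degreeLT (ZMod p) (n+1) : Set (ZMod p)[X])) ?_
  rintro g ⟨_, hg⟩
  rw [SetLike.mem_coe, mem_degreeLT]
  refine lt_of_le_of_lt degree_le_natDegree ?_
  rw [hg]; exact_mod_cast Nat.lt_succ_self n

/-- the finite set of monic polynomials of degree `n`. -/
noncomputable def monicSet (p : ℕ) [Fact p.Prime] (n : ℕ) : Finset (ZMod p)[X] :=
  (monic_finite p n).toFinset

lemma mem_monicSet (p : ℕ) [Fact p.Prime] (n : ℕ) (g : (ZMod p)[X]) :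
    g ∈ monicSet p n ↔ g.Monic ∧ g.natDegree = n := by
  simp [monicSet]

lemma newton (p : ℕ) [Fact p.Prime] (K : ℕ → Type) [∀ k, Field (K k)] [∀ k, Fintype (K k)]
    [∀ k, Algebra (ZMod p) (K k)] (hk : ∀ k ≠ 0, Module.finrank (ZMod p) (K k) = k)
    (lam : (ZMod p)[X] → ℂ) (hlam : ∀ g h : (ZMod p)[X], g.Monic → h.Monic → lam (g * h) = lam g * lam h)
    (n : ℕ) :
    (n : ℂ) * ∑ g ∈ monicSet p n, lam g =
      ∑ k ∈ Icc 1 n, (∑ x : K k, lam (cpoly p k x)) * ∑ g ∈ monicSet p (n - k), lam g := by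
  classical
  have h1 : ∀ k ∈ Icc 1 n, (∑ x : K k, lam (cpoly p k x)) * ∑ g ∈ monicSet p (n - k), lam g =
      ∑ G ∈ monicSet p n, (#{x : K k | cpoly p k x ∣ G} : ℂ) * lam G := by
    intro k hkn
    rw [mem_Icc] at hkn
    have h2 : ∀ x : K k, lam (cpoly p k x) * ∑ g ∈ monicSet p (n - k), lam g =
        ∑ G ∈ monicSet p n, if cpoly p k x ∣ G then lam G else 0 := by
      intro x
      have hm := cpoly_monic p k x
      have hd := cpoly_natDegree p k (hk k (by omega)) x
      rw [Finset.mul_sum, ← Finset.sum_filter]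
      apply Finset.sum_bij (fun g _ => cpoly p k x * g)
      · intro g hg
        rw [mem_monicSet] at hg
        rw [mem_filter, mem_monicSet]
        refine ⟨⟨hm.mul hg.1, ?_⟩, dvd_mul_right _ _⟩
        rw [hm.natDegree_mul hg.1, hd, hg.2]; omega
      · intro a _ b _ hab
        exact mul_left_cancel₀ hm.ne_zero hab
      · intro G hG
        rw [mem_filter, mem_monicSet] at hG
        obtain ⟨⟨hG1, hG2⟩, g, rfl⟩ := hG
        have hgm : g.Monic := hm.of_mul_monic_left hG1
        refine ⟨g, ?_, rfl⟩
        rw [mem_monicSet]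
        refine ⟨hgm, ?_⟩
        rw [hm.natDegree_mul hgm, hd] at hG2
        omega
      · intro g hg
        rw [mem_monicSet] at hg
        rw [hlam _ _ hm hg.1]
    rw [Finset.sum_mul, Finset.sum_congr rfl (fun x _ => h2 x), Finset.sum_comm]
    refine Finset.sum_congr rfl fun G _ => ?_
    rw [← Finset.sum_filter, Finset.sum_const, nsmul_eq_mul]
  rw [Finset.sum_congr rfl h1, Finset.sum_comm, Finset.mul_sum]
  refine Finset.sum_congr rfl fun G hG => ?_
  rw [mem_monicSet] at hG
  rw [← Finset.sum_mul]
  congr 1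
  exact_mod_cast (count_dvd p K hk n G hG.1 hG.2).symm

/-- The multiplicative function on monic polynomials. -/
noncomputable def lamf (p : ℕ) [Fact p.Prime] (χ : MulChar (ZMod p) ℂ) (ψ : AddChar (ZMod p) ℂ)
    (e : ZMod p) (g : (ZMod p)[X]) : ℂ :=
  χ (g.eval 0) * χ⁻¹ (g.eval (-e)) * ψ (- g.nextCoeff)

lemma lamf_mul (p : ℕ) [Fact p.Prime] (χ : MulChar (ZMod p) ℂ) (ψ : AddChar (ZMod p) ℂ)
    (e : ZMod p) (g h : (ZMod p)[X]) (hg : g.Monic) (hh : h.Monic) :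
    lamf p χ ψ e (g * h) = lamf p χ ψ e g * lamf p χ ψ e h := by
  simp only [lamf]
  rw [hg.nextCoeff_mul hh, neg_add, AddChar.map_add_eq_mul, eval_mul, eval_mul, map_mul, map_mul]
  ring

lemma lamf_cpoly (p : ℕ) [Fact p.Prime] (χ : MulChar (ZMod p) ℂ) (ψ : AddChar (ZMod p) ℂ)
    (e : ZMod p) (k : ℕ) {K : Type} [Field K] [Fintype K]
    [Algebra (ZMod p) K] (hk : Module.finrank (ZMod p) K = k) (x : K) :
    lamf p χ ψ e (cpoly p k x) = χ (Algebra.norm (ZMod p) x) *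
      χ⁻¹ (Algebra.norm (ZMod p) (x + algebraMap (ZMod p) K e)) * ψ (Algebra.trace (ZMod p) K x) := by
  rw [norm_eq_coeff p k hk x, norm_eq_coeff p k hk (x + _), cpoly_add, trace_eq_nextCoeff p k hk x]
  simp only [lamf, map_mul]
  have hone : χ ((-1) ^ k) * χ⁻¹ ((-1) ^ k) = 1 := by
    have : ((-1 : ZMod p)) ^ k ≠ 0 := pow_ne_zero _ (neg_ne_zero.2 one_ne_zero)
    rw [MulChar.inv_apply', ← map_mul, mul_inv_cancel₀ this, map_one]
  linear_combination -χ ((cpoly p k x).eval 0) * χ⁻¹ ((cpoly p k x).eval (-e)) * ψ (-(cpoly p k x).nextCoeff) * hone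

lemma sum_lamf_eq_zero (p : ℕ) [Fact p.Prime] (χ : MulChar (ZMod p) ℂ) (hχ : χ ≠ 1)
    (ψ : AddChar (ZMod p) ℂ)
    (e : ZMod p) (he : e ≠ 0) (n : ℕ) (hn : 3 ≤ n) : ∑ g ∈ monicSet p n, lamf p χ ψ e g = 0 := by
  classical
  let v : (ZMod p) → (ZMod p)[X] := fun s => C s * (X + C e)
  have hv : ∀ s, (v s).natDegree ≤ 1 := by
    intro s
    refine (natDegree_C_mul_le _ _).trans ?_
    rw [natDegree_X_add_C]
  have hmem : ∀ s g, g ∈ monicSet p n → g + v s ∈ monicSet p n := by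
    intro s g hg
    rw [mem_monicSet] at hg ⊢
    have hlt : (v s).degree < g.degree := by
      refine degree_lt_degree ?_
      have := hv s; omega
    refine ⟨hg.1.add_of_left hlt, ?_⟩
    rw [natDegree_add_eq_left_of_degree_lt hlt, hg.2]
  have hshift : ∀ s, ∑ g ∈ monicSet p n, lamf p χ ψ e (g + v s) = ∑ g ∈ monicSet p n, lamf p χ ψ e g := by
    intro s
    apply Finset.sum_bij (fun g _ => g + v s)
    · intro g hg; exact hmem s g hg
    · intro a _ b _ hab; exact add_right_cancel hab
    · intro g hg
      refine ⟨g + v (-s), hmem (-s) g hg, ?_⟩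
      simp only [v, C_neg]; ring
    · intros; rfl
  have hval : ∀ s g, g ∈ monicSet p n → lamf p χ ψ e (g + v s) =
      χ (g.eval 0 + s * e) * (χ⁻¹ (g.eval (-e)) * ψ (- g.nextCoeff)) := by
    intro s g hg
    have hg' := (mem_monicSet p n _).1 (hmem s g hg)
    rw [mem_monicSet] at hg
    have hnc : (g + v s).nextCoeff = g.nextCoeff := by
      rw [nextCoeff_of_natDegree_pos (by omega), nextCoeff_of_natDegree_pos (by omega), hg'.2, hg.2,
        coeff_add, coeff_eq_zero_of_natDegree_lt (p := v s), add_zero]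
      have := hv s; omega
    simp only [lamf]
    rw [hnc, eval_add, eval_add]
    simp only [v, eval_mul, eval_C, eval_add, eval_X]
    rw [neg_add_cancel, mul_zero, add_zero, zero_add, mul_assoc]
  have htot : ∑ s : ZMod p, ∑ g ∈ monicSet p n, lamf p χ ψ e (g + v s) = 0 := by
    rw [Finset.sum_comm]
    apply Finset.sum_eq_zero
    intro g hg
    rw [Finset.sum_congr rfl (fun s _ => hval s g hg), ← Finset.sum_mul]
    have : ∑ s : ZMod p, χ (g.eval 0 + s * e) = ∑ a : ZMod p, χ a := by
      apply Fintype.sum_bijective (fun s => g.eval 0 + s * e)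
      · exact (Equiv.addLeft (g.eval 0)).bijective.comp (mulRight_bijective₀ e he)
      · intro; rfl
    rw [this, MulChar.sum_eq_zero_of_ne_one hχ, zero_mul]
  rw [Finset.sum_congr rfl (fun s _ => hshift s), Finset.sum_const, nsmul_eq_mul] at htot
  rcases mul_eq_zero.1 htot with h | h
  · exfalso
    simp at h
    exact (Fact.out : p.Prime).ne_zero h
  · exact h

lemma sum_lamf_zero (p : ℕ) [Fact p.Prime] (χ : MulChar (ZMod p) ℂ) 
    (ψ : AddChar (ZMod p) ℂ) (e : ZMod p) : ∑ g ∈ monicSet p 0, lamf p χ ψ e g = 1 := by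
  have : monicSet p 0 = {1} := by
    ext g
    rw [mem_monicSet, Finset.mem_singleton]
    constructor
    · rintro ⟨h1, h2⟩
      exact h1.natDegree_eq_zero.1 h2
    · rintro rfl
      exact ⟨monic_one, natDegree_one⟩
  rw [this, Finset.sum_singleton]
  simp [lamf, nextCoeff]

lemma power_sums (a1 a2 : ℂ) (W : ℕ → ℂ) (h1 : W 1 = a1) (h2 : 2 * a2 = W 1 * a1 + W 2)
    (h3 : ∀ n, 3 ≤ n → W n + W (n-1) * a1 + W (n-2) * a2 = 0) :
    ∃ ω : Fin 2 → ℂ, ∀ n, 1 ≤ n → W n = - ∑ i, ω i ^ n := by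
  obtain ⟨s, hs⟩ := IsAlgClosed.exists_pow_nat_eq (a1 ^ 2 - 4 * a2) (n := 2) (by norm_num)
  refine ⟨![(-a1 + s) / 2, (-a1 - s) / 2], ?_⟩
  intro n
  induction n using Nat.strong_induction_on with
  | _ n ih =>
    intro hn
    simp only [Fin.sum_univ_two, Matrix.cons_val_zero, Matrix.cons_val_one] at ih ⊢
    rcases Nat.lt_or_ge n 3 with h | h
    · interval_cases n
      · rw [h1]; ring
      · linear_combination -h2 - a1 * h1 + hs / 2
    · obtain ⟨k, rfl⟩ : ∃ k, n = k + 3 := ⟨n - 3, by omega⟩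
      have e1 := ih (k + 2) (by omega) (by omega)
      have e2 := ih (k + 1) (by omega) (by omega)
      have e3 := h3 (k + 3) (by omega)
      rw [show k + 3 - 1 = k + 2 by omega, show k + 3 - 2 = k + 1 by omega] at e3
      rw [e1, e2] at e3
      set u := (-a1 + s) / 2 with hu
      set v := (-a1 - s) / 2 with hv
      have hu2 : u ^ 2 + a1 * u + a2 = 0 := by rw [hu]; linear_combination hs / 4
      have hv2 : v ^ 2 + a1 * v + a2 = 0 := by rw [hv]; linear_combination hs / 4
      linear_combination e3 + u ^ (k+1) * hu2 + v ^ (k+1) * hv2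

lemma exists_roots (p : ℕ) [Fact p.Prime] (K : ℕ → Type) [∀ k, Field (K k)] [∀ k, Fintype (K k)]
    [∀ k, Algebra (ZMod p) (K k)] (hk : ∀ k ≠ 0, Module.finrank (ZMod p) (K k) = k)
    (χ : MulChar (ZMod p) ℂ) (hχ : χ ≠ 1) (ψ : AddChar (ZMod p) ℂ) (e : ZMod p) (he : e ≠ 0) :
    ∃ ω : Fin 2 → ℂ, ∀ n, 1 ≤ n → ∑ x : K n, χ (Algebra.norm (ZMod p) x) *
      χ⁻¹ (Algebra.norm (ZMod p) (x + algebraMap (ZMod p) (K n) e)) * ψ (Algebra.trace (ZMod p) (K n) x)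
        = - ∑ i, ω i ^ n := by
  let a : ℕ → ℂ := fun n => ∑ g ∈ monicSet p n, lamf p χ ψ e g
  let W : ℕ → ℂ := fun n => ∑ x : K n, lamf p χ ψ e (cpoly p n x)
  have hN : ∀ n : ℕ, (n : ℂ) * a n = ∑ k ∈ Icc 1 n, W k * a (n - k) :=
    newton p K hk (lamf p χ ψ e) (lamf_mul p χ ψ e)
  have ha0 : a 0 = 1 := sum_lamf_zero p χ ψ e
  have ha : ∀ n, 3 ≤ n → a n = 0 := sum_lamf_eq_zero p χ hχ ψ e he
  obtain ⟨ω, hω⟩ := power_sums (a 1) (a 2) W (by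
    have := hN 1
    simp [ha0] at this
    exact this.symm) (by
    have := hN 2
    rw [Finset.sum_Icc_succ_top (by norm_num)] at this
    simpa [ha0] using this) (by
    intro n hn
    have := hN n
    rw [ha n hn, mul_zero] at this
    obtain ⟨k, rfl⟩ : ∃ k, n = k + 3 := ⟨n - 3, by omega⟩
    rw [Finset.sum_Icc_succ_top (by omega), Finset.sum_Icc_succ_top (by omega),
      Finset.sum_Icc_succ_top (by omega)] at this
    have hz : ∑ j ∈ Icc 1 k, W j * a (k + 3 - j) = 0 := by
      apply Finset.sum_eq_zero
      intro j hj
      rw [mem_Icc] at hj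
      rw [ha _ (by omega), mul_zero]
    rw [hz, show k + 2 + 1 - (k + 1) = 2 by omega, show k + 2 + 1 - (k + 1 + 1) = 1 by omega,
      Nat.sub_self, ha0] at this
    rw [show k + 3 - 1 = k + 2 by omega, show k + 3 - 2 = k + 1 by omega]
    linear_combination -this)
  refine ⟨ω, fun n hn => ?_⟩
  rw [← hω n hn]
  refine Finset.sum_congr rfl fun x _ => ?_
  rw [lamf_cpoly p χ ψ e n (hk n (by omega)) x]

lemma power_sum_bound {ι : Type*} [Fintype ι] (z : ι → ℂ) (B : ℝ) (k0 : ℕ)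
    (h : ∀ k ≥ k0, ‖∑ i, z i ^ k‖ ≤ B) (j : ι) : ‖z j‖ ≤ 1 := by
  by_contra! hj
  have hu : ∀ i, ∃ u : ℂ, ‖u‖ = 1 ∧ z i = ‖z i‖ * u := by
    intro i
    by_cases hz : z i = 0
    · exact ⟨1, by simp, by simp [hz]⟩
    · refine ⟨z i / ‖z i‖, by simp [hz], ?_⟩
      have : (‖z i‖ : ℂ) ≠ 0 := by simpa using hz
      field_simp
  choose u hu1 hu2 using hu
  obtain ⟨a, -, φ, hφ, hlim⟩ := tendsto_subseq_of_bounded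
    (Metric.isBounded_closedBall (x := (0 : ι → ℂ)) (r := 1))
    (x := fun n : ℕ => (fun i => u i ^ n)) (by
      intro n
      rw [mem_closedBall_zero_iff, pi_norm_le_iff_of_nonneg zero_le_one]
      intro i
      simp [hu1])
  obtain ⟨M, hM⟩ := Metric.cauchySeq_iff.1 hlim.cauchySeq (1/2) (by norm_num)
  obtain ⟨n0, hn0⟩ := (Filter.tendsto_atTop.1 (tendsto_pow_atTop_atTop_of_one_lt hj) (2 * B + 1)).exists_forall_of_atTop
  set m := φ M + M + k0 + n0 with hm
  have h1 := hφ.id_le m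
  simp only [id] at h1
  set n := φ m - φ M with hn
  have hnk : k0 ≤ n := by omega
  have hnn : n0 ≤ n := by omega
  have hclose : ∀ i, 1/2 ≤ (u i ^ n).re := by
    intro i
    have h2 := hM m (by omega) M le_rfl
    rw [dist_pi_lt_iff (by norm_num)] at h2
    have h3 := h2 i
    simp only [Function.comp, dist_eq_norm] at h3
    have h4 : u i ^ φ m - u i ^ φ M = u i ^ φ M * (u i ^ n - 1) := by
      rw [mul_sub, ← pow_add, mul_one]; congr 2; omega
    rw [h4, norm_mul, norm_pow, hu1, one_pow, one_mul] at h3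
    have h5 := Complex.abs_re_le_norm (u i ^ n - 1)
    rw [Complex.sub_re, Complex.one_re] at h5
    have := (abs_le.1 h5).1
    linarith
  have hre : ∀ i, ‖z i‖ ^ n / 2 ≤ (z i ^ n).re := by
    intro i
    have : z i ^ n = ((‖z i‖ ^ n : ℝ) : ℂ) * u i ^ n := by
      conv_lhs => rw [hu2 i, mul_pow]
      push_cast; rfl
    rw [this, Complex.re_ofReal_mul]
    have := mul_le_mul_of_nonneg_left (hclose i) (pow_nonneg (norm_nonneg (z i)) n)
    linarith
  have hs : ‖z j‖ ^ n / 2 ≤ (∑ i, z i ^ n).re := by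
    rw [Complex.re_sum]
    refine (hre j).trans (Finset.single_le_sum (f := fun i => (z i ^ n).re) (fun i _ => ?_) (Finset.mem_univ j))
    exact le_trans (by positivity) (hre i)
  have h6 := hn0 n hnn
  have h7 := h n hnk
  have h8 := Complex.re_le_norm (∑ i, z i ^ n)
  linarith

lemma weil_prime (p : ℕ) [Fact p.Prime] (hp : 2 < p) (e : ZMod p) (he : e ≠ 0)
    (χ : MulChar (ZMod p) ℂ) (hχ : χ ≠ 1) (ψ : AddChar (ZMod p) ℂ) :
    ‖∑ x : ZMod p, χ x * χ⁻¹ (x + e) * ψ x‖ ≤ 2 * √p := by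
  classical
  have : ∀ k, Fintype (GaloisField p k) := fun k => Fintype.ofFinite _
  have hp0 : (0 : ℝ) < p := by positivity
  obtain ⟨B, μ0, hB⟩ := sum_psi_bound p hp e he χ hχ
  choose ω hω using fun ψ => exists_roots p (GaloisField p) (fun k hk => GaloisField.finrank p hk) χ hχ ψ e he
  have hz : ∀ i : AddChar (ZMod p) ℂ × Fin 2, ‖ω i.1 i.2 ^ 2 / p‖ ≤ 1 := by
    apply power_sum_bound (fun i : AddChar (ZMod p) ℂ × Fin 2 => ω i.1 i.2 ^ 2 / p) B (μ0 + 1)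
    intro μ hμ
    have h1 := hB μ (by omega) (GaloisField p (2 * μ)) (by
      rw [← Nat.card_eq_fintype_card, GaloisField.card p _ (by omega), ← pow_add, two_mul])
    simp_rw [fun ψ => hω ψ (2 * μ) (by omega)] at h1
    rw [Finset.sum_neg_distrib, norm_neg] at h1
    have h2 : ∑ i : AddChar (ZMod p) ℂ × Fin 2, (ω i.1 i.2 ^ 2 / p : ℂ) ^ μ =
        (∑ ψ : AddChar (ZMod p) ℂ, ∑ i, ω ψ i ^ (2 * μ)) / p ^ μ := by
      rw [Fintype.sum_prod_type, Finset.sum_div]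
      refine Finset.sum_congr rfl fun ψ _ => ?_
      rw [Finset.sum_div]
      refine Finset.sum_congr rfl fun i _ => ?_
      rw [div_pow, pow_mul]
    rw [h2, norm_div, norm_pow, Complex.norm_natCast]
    rw [div_le_iff₀ (by positivity)]
    exact h1
  have hroot : ∀ ψ i, ‖ω ψ i‖ ≤ √p := by
    intro ψ i
    have := hz (ψ, i)
    rw [norm_div, norm_pow, Complex.norm_natCast, div_le_one hp0] at this
    exact Real.le_sqrt_of_sq_le this
  have h1 := hω ψ 1 le_rfl
  have hfr : Module.finrank (ZMod p) (GaloisField p 1) = 1 := GaloisField.finrank p one_ne_zero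
  have hbij : Function.Bijective (algebraMap (ZMod p) (GaloisField p 1)) := by
    rw [Fintype.bijective_iff_injective_and_card]
    refine ⟨(algebraMap (ZMod p) (GaloisField p 1)).injective, ?_⟩
    rw [← Nat.card_eq_fintype_card, ← Nat.card_eq_fintype_card, GaloisField.card p _ one_ne_zero]
    simp
  have h2 : ∑ x : ZMod p, χ x * χ⁻¹ (x + e) * ψ x = - ∑ i, ω ψ i ^ 1 := by
    rw [← h1]
    refine Fintype.sum_bijective _ hbij _ _ fun x => ?_
    rw [← map_add, Algebra.norm_algebraMap, Algebra.norm_algebraMap, Algebra.trace_algebraMap, hfr]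
    simp
  rw [h2, norm_neg, Fin.sum_univ_two, pow_one, pow_one]
  have := norm_add_le (ω ψ 0) (ω ψ 1)
  linarith [hroot ψ 0, hroot ψ 1]

lemma exists_crt (q : ℕ) (hq : Squarefree q) :
    Nonempty (ZMod q ≃+* ((p : q.primeFactors) → ZMod (p : ℕ))) := by
  have h1 : q = ∏ p : q.primeFactors, (p : ℕ) := by
    conv_lhs => rw [← Nat.prod_primeFactors_of_squarefree hq]
    rw [← Finset.prod_coe_sort]
  have hc : Pairwise (Function.onFun Nat.Coprime fun p : q.primeFactors => (p : ℕ)) := by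
    intro a b hab
    exact (Nat.coprime_primes (Nat.prime_of_mem_primeFactors a.2)
      (Nat.prime_of_mem_primeFactors b.2)).2 fun h => hab (Subtype.ext h)
  exact ⟨(ZMod.ringEquivCongr h1).trans (ZMod.prodEquivPi _ hc)⟩

noncomputable def localChar {ι : Type*} [DecidableEq ι] {R : Type*} [CommRing R] {S : ι → Type*}
    [∀ i, CommRing (S i)] (E : R ≃+* ((i : ι) → S i)) (χ : MulChar R ℂ) (i : ι) :
    MulChar (S i) ℂ where
  toFun a := χ (E.symm (Pi.mulSingle i a))
  map_one' := by simp
  map_mul' a b := by rw [Pi.mulSingle_mul, map_mul, map_mul]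
  map_nonunit' a ha := by
    apply χ.map_nonunit
    intro h
    apply ha
    have h2 := h.map E
    rw [RingEquiv.apply_symm_apply, Pi.isUnit_iff] at h2
    simpa using h2 i

lemma localChar_prod {ι : Type*} [DecidableEq ι] [Fintype ι] {R : Type*} [CommRing R] {S : ι → Type*}
    [∀ i, CommRing (S i)] (E : R ≃+* ((i : ι) → S i)) (χ : MulChar R ℂ) (n : R) :
    χ n = ∏ i, localChar E χ i (E n i) := by
  have h : n = E.symm (∏ i, Pi.mulSingle i (E n i)) := by
    rw [Finset.univ_prod_mulSingle, RingEquiv.symm_apply_apply]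
  conv_lhs => rw [h, map_prod, map_prod]
  rfl

noncomputable def localAdd {ι : Type*} [DecidableEq ι] {R : Type*} [CommRing R] {S : ι → Type*}
    [∀ i, CommRing (S i)] (E : R ≃+* ((i : ι) → S i)) (ψ : AddChar R ℂ) (i : ι) :
    AddChar (S i) ℂ where
  toFun a := ψ (E.symm (Pi.single i a))
  map_zero_eq_one' := by simp
  map_add_eq_mul' a b := by rw [Pi.single_add, map_add, AddChar.map_add_eq_mul]

lemma localAdd_prod {ι : Type*} [DecidableEq ι] [Fintype ι] {R : Type*} [CommRing R] {S : ι → Type*}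
    [∀ i, CommRing (S i)] (E : R ≃+* ((i : ι) → S i)) (ψ : AddChar R ℂ) (n : R) :
    ψ n = ∏ i, localAdd E ψ i (E n i) := by
  have h : n = E.symm (∑ i, Pi.single i (E n i)) := by
    rw [Finset.univ_sum_single, RingEquiv.symm_apply_apply]
  have h2 : ∀ (s : Finset ι) (f : ι → R), ψ (∑ i ∈ s, f i) = ∏ i ∈ s, ψ (f i) := by
    intro s f
    induction s using Finset.induction_on with
    | empty => simp
    | insert a s ha ih => rw [Finset.sum_insert ha, Finset.prod_insert ha, AddChar.map_add_eq_mul, ih]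
  conv_lhs => rw [h, map_sum, h2]
  rfl

lemma localChar_ne_one (q : ℕ) (hq : Squarefree q)
    (E : ZMod q ≃+* ((p : q.primeFactors) → ZMod (p : ℕ)))
    (χ : DirichletCharacter ℂ q) (hχ : χ.IsPrimitive) (p : q.primeFactors) :
    localChar E χ p ≠ 1 := by
  intro h1
  have hq0 : q ≠ 0 := hq.ne_zero
  have : NeZero q := ⟨hq0⟩
  have hpp := Nat.prime_of_mem_primeFactors p.2
  have hpq := Nat.dvd_of_mem_primeFactors p.2
  have hd : q / p ∣ q := Nat.div_dvd_of_dvd hpq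
  have hf : χ.FactorsThrough (q / p) := by
    rw [DirichletCharacter.factorsThrough_iff_ker_unitsMap hd]
    intro u hu
    rw [MonoidHom.mem_ker] at hu ⊢
    have hu' : ZMod.castHom hd (ZMod (q / p)) (u : ZMod q) = 1 := by
      have := congrArg Units.val hu
      simpa [ZMod.unitsMap_def] using this
    have key : ∀ r : q.primeFactors, r ≠ p → E u r = 1 := by
      intro r hr
      have hrp := Nat.prime_of_mem_primeFactors r.2
      have hrd : (r : ℕ) ∣ q / p := by
        have h3 : (r : ℕ) ∣ p * (q / p) := by
          rw [Nat.mul_div_cancel' hpq]; exact Nat.dvd_of_mem_primeFactors r.2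
        exact (Nat.Coprime.dvd_of_dvd_mul_left ((Nat.coprime_primes hrp hpp).2
          fun h => hr (Subtype.ext h)) h3)
      have h4 : ((Pi.evalRingHom (fun r : q.primeFactors => ZMod (r : ℕ)) r).comp E.toRingHom) =
        (ZMod.castHom hrd (ZMod (r : ℕ))).comp (ZMod.castHom hd (ZMod (q / p))) :=
        Subsingleton.elim _ _
      have h5 := RingHom.congr_fun h4 (u : ZMod q)
      rw [RingHom.comp_apply, RingHom.comp_apply, hu', map_one] at h5
      exact h5
    have h6 : χ (u : ZMod q) = 1 := by
      rw [localChar_prod E χ]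
      apply Finset.prod_eq_one
      intro r _
      by_cases hr : r = p
      · subst hr
        rw [h1]
        have h7 := (u.isUnit.map E)
        rw [Pi.isUnit_iff] at h7
        exact MulChar.one_apply (h7 r)
      · rw [key r hr, map_one]
    ext
    simpa using h6
  have h2 := DirichletCharacter.conductor_le_conductor_mem_conductorSet (χ := χ) (d := q / p) hf
  have h3 : χ.conductor ≤ q / p := Nat.le_of_dvd (Nat.div_pos (Nat.le_of_dvd (by omega) hpq) hpp.pos)
    (χ.conductor_dvd_of_mem_conductorSet hf)
  rw [hχ] at h3
  have := Nat.div_lt_self (by omega : 0 < q) hpp.one_lt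
  omega

lemma weil_squarefree (q : ℕ) [NeZero q] (hq : Squarefree q) (χ : DirichletCharacter ℂ q)
    (hχ : χ.IsPrimitive) (h : ZMod q) (hh : IsUnit h) (ψ : AddChar (ZMod q) ℂ) :
    ‖∑ n : ZMod q, χ n * (starRingEnd ℂ) (χ (n + h)) * ψ n‖ ≤ 2 ^ q.primeFactors.card * √q := by
  classical
  obtain ⟨E⟩ := exists_crt q hq
  have hF : ∀ p : q.primeFactors, Fact (p : ℕ).Prime := fun p => ⟨Nat.prime_of_mem_primeFactors p.2⟩
  have h1 : ∑ n : ZMod q, χ n * (starRingEnd ℂ) (χ (n + h)) * ψ n =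
      ∏ p : q.primeFactors, ∑ x : ZMod (p : ℕ), localChar E χ p x *
        (localChar E χ p)⁻¹ (x + E h p) * localAdd E ψ p x := by
    rw [Finset.prod_univ_sum, Fintype.piFinset_univ]
    refine Fintype.sum_equiv E.toEquiv _ _ fun n => ?_
    rw [localChar_prod E χ n, localChar_prod E χ (n + h), localAdd_prod E ψ n, map_prod,
      ← Finset.prod_mul_distrib, ← Finset.prod_mul_distrib]
    refine Finset.prod_congr rfl fun p _ => ?_
    rw [← MulChar.star_eq_inv, MulChar.star_apply, map_add]
    rfl
  rw [h1, norm_prod]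
  have h2 : (2 : ℝ) ^ q.primeFactors.card * √q = ∏ p : q.primeFactors, (2 * √((p : ℕ) : ℝ)) := by
    rw [Finset.prod_mul_distrib, Finset.prod_const, Finset.card_univ, Fintype.card_coe]
    congr 1
    rw [← Real.sqrt_prod _ (fun i _ => by positivity)]
    congr 1
    conv_lhs => rw [← Nat.prod_primeFactors_of_squarefree hq]
    rw [Finset.prod_coe_sort q.primeFactors (fun p => (p : ℝ))]
    push_cast
    rfl
  rw [h2]
  refine Finset.prod_le_prod (fun _ _ => norm_nonneg _) fun p _ => ?_
  have hne := localChar_ne_one q hq E χ hχ p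
  have hp2 : 2 < (p : ℕ) := by
    refine lt_of_le_of_ne (hF p).out.two_le fun h2 => hne ?_
    ext u
    have hu : u = 1 := by
      have h3 : ∀ m : ℕ, 2 = m → ∀ v : (ZMod m)ˣ, v = 1 := by
        rintro m rfl v
        exact Subsingleton.elim _ _
      exact h3 _ h2 u
    rw [hu]; simp
  have he : E h p ≠ 0 := by
    have h7 := hh.map E
    rw [Pi.isUnit_iff] at h7
    exact (h7 p).ne_zero
  exact weil_prime p hp2 _ he _ hne _

lemma geom_bound (q : ℕ) [NeZero q] (k : ZMod q) (hk : k ≠ 0) (a b : ℤ) :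
    ‖∑ n ∈ Finset.Icc a b, ZMod.stdAddChar (k * (n : ZMod q))‖ ≤
      q / 2 * (1 / (k.val : ℝ) + 1 / (q - k.val : ℝ)) := by
  have hq : (0 : ℝ) < q := by have := NeZero.pos q; positivity
  have hk1 : 1 ≤ k.val := Nat.one_le_iff_ne_zero.2 ((ZMod.val_ne_zero k).2 hk)
  have hk2 : k.val < q := ZMod.val_lt k
  have hk1' : (1 : ℝ) ≤ k.val := by exact_mod_cast hk1
  have hk2' : (k.val : ℝ) < q := by exact_mod_cast hk2
  set t : ℝ := (k.val : ℝ) with ht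
  have hmt : 0 < q - t := by linarith
  rcases lt_or_ge b a with hba | hab
  · rw [Finset.Icc_eq_empty (by omega)]
    simp only [Finset.sum_empty, norm_zero]
    positivity
  set z : ℂ := ZMod.stdAddChar k with hz
  have hnorm : ∀ m : ℤ, ‖(ZMod.stdAddChar (k * (m : ZMod q)) : ℂ)‖ = 1 := fun m => AddChar.norm_apply _ _
  have htel : (z - 1) * ∑ n ∈ Finset.Icc a b, (ZMod.stdAddChar (k * (n : ZMod q)) : ℂ) =
      ZMod.stdAddChar (k * ((b + 1 : ℤ) : ZMod q)) - ZMod.stdAddChar (k * (a : ZMod q)) := by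
    induction b, hab using Int.leInduction with
    | base =>
      rw [Finset.Icc_self, Finset.sum_singleton]
      push_cast
      rw [mul_add, AddChar.map_add_eq_mul, mul_one, ← hz]
      ring
    | succ n hn ih =>
      have : Finset.Icc a (n + 1) = insert (n + 1) (Finset.Icc a n) := by
        ext x; simp only [Finset.mem_Icc, Finset.mem_insert]; omega
      rw [this, Finset.sum_insert (by simp), mul_add, ih]
      push_cast
      rw [mul_add k (n + 1 : ZMod q) 1, AddChar.map_add_eq_mul _ (k * (n + 1 : ZMod q)), mul_one, ← hz]
      ring
  have hz1 : ‖z - 1‖ = 2 * Real.sin (Real.pi * t / q) := by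
    have h1 : z = Complex.exp (Complex.I * ((2 * Real.pi * t / q : ℝ) : ℂ)) := by
      rw [hz]
      have : k = ((k.val : ℤ) : ZMod q) := by simp
      rw [this, ZMod.stdAddChar_coe]
      congr 1
      rw [ht]
      push_cast
      simp
      ring
    rw [h1, Complex.norm_exp_I_mul_ofReal_sub_one, Real.norm_eq_abs]
    rw [show 2 * Real.pi * t / q / 2 = Real.pi * t / q by ring]
    apply abs_of_nonneg
    have : 0 ≤ Real.sin (Real.pi * t / q) := by
      apply Real.sin_nonneg_of_nonneg_of_le_pi
      · have := Real.pi_pos; positivity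
      · rw [div_le_iff₀ hq]
        exact mul_le_mul_of_nonneg_left hk2'.le Real.pi_pos.le
    positivity
  have hsin : ∃ s : ℝ, 0 < s ∧ 2 / q * s ≤ Real.sin (Real.pi * t / q) ∧ 1 / s ≤ 1 / t + 1 / (q - t) := by
    rcases le_total t (q - t) with h | h
    · refine ⟨t, by linarith, ?_, by have : 0 ≤ 1 / (q - t) := by positivity
                                     linarith⟩
      refine le_trans (le_of_eq ?_) (Real.mul_le_sin (x := Real.pi * t / q) ?_ ?_)
      · have := Real.pi_ne_zero; field_simp
      · have := Real.pi_pos; positivity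
      · rw [div_le_div_iff₀ hq two_pos]
        nlinarith [Real.pi_pos]
    · refine ⟨q - t, hmt, ?_, by have : 0 ≤ 1 / t := by positivity
                                 linarith⟩
      have e : Real.sin (Real.pi * t / q) = Real.sin (Real.pi * (q - t) / q) := by
        rw [← Real.sin_pi_sub]; congr 1; field_simp
      rw [e]
      refine le_trans (le_of_eq ?_) (Real.mul_le_sin (x := Real.pi * (q - t) / q) ?_ ?_)
      · have := Real.pi_ne_zero; field_simp
      · have := Real.pi_pos; positivity
      · rw [div_le_div_iff₀ hq two_pos]
        nlinarith [Real.pi_pos]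
  obtain ⟨s, hs, hs1, hs2⟩ := hsin
  have h3 := congrArg norm htel
  rw [norm_mul, hz1] at h3
  have h4 := norm_sub_le (ZMod.stdAddChar (k * ((b + 1 : ℤ) : ZMod q)) : ℂ) (ZMod.stdAddChar (k * (a : ZMod q)))
  rw [hnorm, hnorm, ← h3] at h4
  set S := ‖∑ n ∈ Finset.Icc a b, (ZMod.stdAddChar (k * (n : ZMod q)) : ℂ)‖ with hS
  have hS0 : 0 ≤ S := norm_nonneg _
  have h5 : 2 / q * s * S ≤ 1 := by
    have := mul_le_mul_of_nonneg_right hs1 hS0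
    nlinarith
  calc S ≤ q / 2 * (1 / s) := by
        rw [div_mul_div_comm, mul_one, le_div_iff₀ (by positivity)]
        have h6 : q * (2 / q * s * S) ≤ q * 1 := mul_le_mul_of_nonneg_left h5 hq.le
        have h7 : q * (2 / q * s * S) = S * (2 * s) := by field_simp
        linarith
    _ ≤ _ := by gcongr

lemma sum_inv_bound (q : ℕ) [NeZero q] :
    ∑ k : ZMod q, (1 / (k.val : ℝ) + 1 / (q - k.val : ℝ)) ≤ 2 * (1 + Real.log q) := by
  have h0 : ∀ n : ℕ, ∑ i ∈ Finset.range n, (1 : ℝ) / ((i : ℝ) + 1) ≤ 1 + Real.log n := by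
    intro n
    have := harmonic_le_one_add_log n
    simpa [harmonic] using this
  have h1 : ∑ k : ZMod q, (1 / (k.val : ℝ) + 1 / (q - k.val : ℝ)) =
      ∑ j ∈ Finset.range q, (1 / (j : ℝ) + 1 / (q - j : ℝ)) := by
    obtain ⟨m, rfl⟩ := Nat.exists_eq_succ_of_ne_zero (NeZero.ne q)
    exact Fin.sum_univ_eq_sum_range (fun j => 1 / (j : ℝ) + 1 / (((m.succ : ℕ) : ℝ) - j : ℝ)) (m + 1)
  rw [h1, Finset.sum_add_distrib]
  have h2 : ∑ j ∈ Finset.range q, 1 / (j : ℝ) ≤ 1 + Real.log q := by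
    refine le_trans ?_ (h0 q)
    obtain ⟨m, rfl⟩ := Nat.exists_eq_succ_of_ne_zero (NeZero.ne q)
    rw [Finset.sum_range_succ', Finset.sum_range_succ]
    have : (0 : ℝ) ≤ 1 / ((m : ℝ) + 1) := by positivity
    push_cast
    simp only [div_zero, add_zero]
    linarith
  have h3 : ∑ j ∈ Finset.range q, 1 / (q - j : ℝ) ≤ 1 + Real.log q := by
    refine le_trans (le_of_eq ?_) (h0 q)
    rw [← Finset.sum_range_reflect]
    refine Finset.sum_congr rfl fun j hj => ?_
    have hj' := Finset.mem_range.1 hj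
    rw [Nat.cast_sub (by omega), Nat.cast_sub (by omega)]
    congr 1
    push_cast
    ring
  linarith

lemma completion (q : ℕ) [NeZero q] (F : ZMod q → ℂ) (M : ℝ)
    (hM : ∀ ψ : AddChar (ZMod q) ℂ, ‖∑ n, F n * ψ n‖ ≤ M) (a b : ℤ) (N : ℝ) (hN : 0 ≤ N)
    (hab : (b : ℝ) - a ≤ N) :
    ‖∑ n ∈ Finset.Icc a b, F (n : ZMod q)‖ ≤ M * (N / q + 1) * (2 + Real.log q) := by
  classical
  have hq1 : (1 : ℝ) ≤ q := by exact_mod_cast NeZero.pos q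
  have hq : (0 : ℝ) < q := by linarith
  have hqc : (q : ℂ) ≠ 0 := by exact_mod_cast hq.ne'
  have hM0 : 0 ≤ M := (norm_nonneg _).trans (hM 1)
  let S : ZMod q → ℂ := fun k => ∑ n ∈ Finset.Icc a b, ZMod.stdAddChar (k * (n : ZMod q))
  have hF : ∀ n : ZMod q, (q : ℂ) * F n = ∑ k : ZMod q, (∑ m, F m * ZMod.stdAddChar (-k * m)) *
      ZMod.stdAddChar (k * n) := by
    intro n
    have h1 : ∀ m : ZMod q, ∑ k : ZMod q, (ZMod.stdAddChar (k * (n - m)) : ℂ) = if n - m = 0 then (q : ℂ) else 0 := by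
      intro m
      rw [AddChar.sum_mulShift (n - m) (ZMod.isPrimitive_stdAddChar q)]
      simp [ZMod.card]
    simp_rw [Finset.sum_mul]
    rw [Finset.sum_comm]
    have h2 : ∀ m : ZMod q, ∑ k : ZMod q, F m * (ZMod.stdAddChar (-k * m) : ℂ) * ZMod.stdAddChar (k * n) =
        F m * if n - m = 0 then (q : ℂ) else 0 := by
      intro m
      rw [← h1, Finset.mul_sum]
      refine Finset.sum_congr rfl fun k _ => ?_
      rw [mul_assoc, ← AddChar.map_add_eq_mul]
      congr 2
      ring
    simp_rw [h2, sub_eq_zero]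
    simp [mul_comm]
  have hT : (q : ℂ) * ∑ n ∈ Finset.Icc a b, F (n : ZMod q) =
      ∑ k : ZMod q, (∑ m, F m * ZMod.stdAddChar (-k * m)) * S k := by
    rw [Finset.mul_sum]
    simp_rw [hF, S, Finset.mul_sum]
    rw [Finset.sum_comm]
  have hW : ∀ k : ZMod q, ‖∑ m, F m * (ZMod.stdAddChar (-k * m) : ℂ)‖ ≤ M := fun k =>
    hM (AddChar.mulShift ZMod.stdAddChar (-k))
  have hS : ∀ k : ZMod q, ‖S k‖ ≤ (if k = 0 then N + 1 else 0) +
      q / 2 * (1 / (k.val : ℝ) + 1 / (q - k.val : ℝ)) := by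
    intro k
    by_cases hk : k = 0
    · have h1 : ‖S k‖ ≤ N + 1 := by
        simp only [S, hk, zero_mul, AddChar.map_zero_eq_one, Finset.sum_const, Int.card_Icc, nsmul_eq_mul, mul_one,
          Complex.norm_natCast]
        rcases le_total (b + 1 - a) 0 with h | h
        · rw [Int.toNat_of_nonpos h]; simp; linarith
        · have : (((b + 1 - a).toNat : ℤ) : ℝ) = ((b + 1 - a : ℤ) : ℝ) := by rw [Int.toNat_of_nonneg h]
          rw [Int.cast_natCast] at this
          rw [this]; push_cast; linarith
      rw [if_pos hk]
      have : 0 ≤ (q : ℝ) / 2 * (1 / (k.val : ℝ) + 1 / (q - k.val : ℝ)) := by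
        rw [hk]; simp; positivity
      linarith
    · rw [if_neg hk, zero_add]
      exact geom_bound q k hk a b
  have hsum : ∑ k : ZMod q, ‖S k‖ ≤ (N + 1) + q * (1 + Real.log q) := by
    refine (Finset.sum_le_sum fun k _ => hS k).trans ?_
    rw [Finset.sum_add_distrib, Finset.sum_ite_eq' Finset.univ (0 : ZMod q), if_pos (Finset.mem_univ _), ← Finset.mul_sum]
    have := mul_le_mul_of_nonneg_left (sum_inv_bound q) (by positivity : (0 : ℝ) ≤ q / 2)
    linarith
  have hlog : 0 ≤ Real.log q := Real.log_nonneg hq1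
  have h5 : q * ‖∑ n ∈ Finset.Icc a b, F (n : ZMod q)‖ ≤ M * ((N + 1) + q * (1 + Real.log q)) := by
    have := congrArg norm hT
    rw [norm_mul, Complex.norm_natCast] at this
    rw [this]
    refine (norm_sum_le _ _).trans ?_
    refine le_trans ?_ (mul_le_mul_of_nonneg_left hsum hM0)
    rw [Finset.mul_sum]
    refine Finset.sum_le_sum fun k _ => ?_
    rw [norm_mul]
    exact mul_le_mul_of_nonneg_right (hW k) (norm_nonneg _)
  have h6 : (N + 1) + q * (1 + Real.log q) ≤ q * ((N / q + 1) * (2 + Real.log q)) := by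
    have : q * ((N / q + 1) * (2 + Real.log q)) = (N + q) * (2 + Real.log q) := by field_simp
    rw [this]
    nlinarith [mul_nonneg hN hlog]
  have h7 := h5.trans (mul_le_mul_of_nonneg_left h6 hM0)
  have h8 : M * (q * ((N / q + 1) * (2 + Real.log q))) = q * (M * (N / q + 1) * (2 + Real.log q)) := by ring
  rw [h8] at h7
  exact le_of_mul_le_mul_left h7 hq

lemma two_pow_omega_bound (δ : ℝ) (hδ : 0 < δ) : ∃ B : ℝ, 0 < B ∧ ∀ q : ℕ, Squarefree q →
    (2 : ℝ) ^ q.primeFactors.card ≤ B * (q : ℝ) ^ δ := by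
  set P : ℕ := ⌈(2 : ℝ) ^ (1 / δ)⌉₊ with hP
  refine ⟨2 ^ P, by positivity, fun q hq => ?_⟩
  have h1 : (q : ℝ) ^ δ = ∏ p ∈ q.primeFactors, (p : ℝ) ^ δ := by
    rw [Real.finsetProd_rpow _ _ (fun i _ => by positivity)]
    conv_lhs => rw [← Nat.prod_primeFactors_of_squarefree hq]
    push_cast
    rfl
  have h2 : ∏ p ∈ q.primeFactors, (if p < P then (2 : ℝ) else 1) ≤ 2 ^ P := by
    rw [Finset.prod_ite, Finset.prod_const, Finset.prod_const_one, mul_one]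
    apply pow_le_pow_right₀ one_le_two
    calc _ ≤ (Finset.range P).card := Finset.card_le_card fun x hx => by
            simp only [Finset.mem_filter] at hx; exact Finset.mem_range.2 hx.2
      _ = P := Finset.card_range P
  calc (2 : ℝ) ^ q.primeFactors.card = ∏ p ∈ q.primeFactors, (2 : ℝ) := by rw [Finset.prod_const]
    _ ≤ ∏ p ∈ q.primeFactors, ((if p < P then (2 : ℝ) else 1) * (p : ℝ) ^ δ) := by
        refine Finset.prod_le_prod (fun _ _ => by norm_num) fun p hp => ?_
        have hp1 : (1 : ℝ) ≤ p := by exact_mod_cast (Nat.prime_of_mem_primeFactors hp).one_lt.le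
        split_ifs with h
        · have := Real.one_le_rpow hp1 hδ.le
          linarith
        · rw [one_mul]
          have h3 : (2 : ℝ) ^ (1 / δ) ≤ p := (Nat.le_ceil _).trans (by exact_mod_cast not_lt.1 h)
          have h4 := Real.rpow_le_rpow (by positivity) h3 hδ.le
          rwa [← Real.rpow_mul (by norm_num), one_div_mul_cancel hδ.ne', Real.rpow_one] at h4
    _ = (∏ p ∈ q.primeFactors, (if p < P then (2 : ℝ) else 1)) * (q : ℝ) ^ δ := by
        rw [Finset.prod_mul_distrib, h1]
    _ ≤ _ := by gcongr

end WeilHelpers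



/-- For `q` squarefree, `χ` primitive mod `q`, `gcd(h,q) = 1` and any interval
`I` of length at most `N`:
`∑_{n∈I} χ(n) conj χ(n+h) ≪_ε (N/q + 1) q^{1/2+ε}`. -/
theorem shifted_char_sum_weil_bound :
    ∀ ε : ℝ, 0 < ε → ∃ C : ℝ, 0 < C ∧
      ∀ q : ℕ, 0 < q → Squarefree q →
      ∀ χ : DirichletCharacter ℂ q, χ.IsPrimitive →
      ∀ h : ℤ, Int.gcd h q = 1 →
      ∀ (a b : ℤ) (N : ℝ), 0 ≤ N → ((b : ℝ) - a) ≤ N →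
        ‖∑ n ∈ Finset.Icc a b,
            χ (n : ZMod q) * (starRingEnd ℂ) (χ ((n + h : ℤ) : ZMod q))‖ ≤
          C * (N / q + 1) * (q : ℝ) ^ ((1 : ℝ) / 2 + ε) := by
  intro ε hε
  obtain ⟨B, hB, hBq⟩ := two_pow_omega_bound (ε / 2) (by positivity)
  refine ⟨B * (2 + 1 / (ε / 2)), by positivity, ?_⟩
  intro q hq0 hq χ hχ h hh a b N hN hab
  have : NeZero q := ⟨hq0.ne'⟩
  have hq1 : (1 : ℝ) ≤ q := by exact_mod_cast hq0
  have hqp : (0 : ℝ) < q := by linarith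
  have hu : IsUnit ((h : ℤ) : ZMod q) := by
    rw [ZMod.coe_int_isUnit_iff_isCoprime, isCoprime_comm, Int.isCoprime_iff_gcd_eq_one]
    exact hh
  have h1 := completion q (fun n => χ n * (starRingEnd ℂ) (χ (n + (h : ZMod q))))
    (2 ^ q.primeFactors.card * √q) (fun ψ => weil_squarefree q hq χ hχ _ hu ψ) a b N hN hab
  have h2 := hBq q hq
  have h3 : 2 + Real.log q ≤ (2 + 1 / (ε / 2)) * (q : ℝ) ^ (ε / 2) := by
    have e1 := Real.log_le_rpow_div hqp.le (by positivity : 0 < ε / 2)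
    have e2 := Real.one_le_rpow hq1 (by positivity : 0 ≤ ε / 2)
    have e3 : (2 + 1 / (ε / 2)) * (q : ℝ) ^ (ε / 2) = 2 * (q : ℝ) ^ (ε / 2) + (q : ℝ) ^ (ε / 2) / (ε / 2) := by ring
    rw [e3]; linarith
  have hlog : 0 ≤ Real.log q := Real.log_nonneg hq1
  have h4 : (q : ℝ) ^ ((1 : ℝ) / 2 + ε) = √q * ((q : ℝ) ^ (ε / 2) * (q : ℝ) ^ (ε / 2)) := by
    rw [Real.sqrt_eq_rpow, ← Real.rpow_add hqp, ← Real.rpow_add hqp]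
    congr 1; ring
  have h5 : ∀ n : ℤ, ((n + h : ℤ) : ZMod q) = (n : ZMod q) + (h : ZMod q) := fun n => by push_cast; rfl
  simp_rw [h5]
  refine h1.trans ?_
  rw [h4]
  calc 2 ^ q.primeFactors.card * √q * (N / q + 1) * (2 + Real.log q)
      ≤ (B * (q : ℝ) ^ (ε / 2)) * √q * (N / q + 1) * ((2 + 1 / (ε / 2)) * (q : ℝ) ^ (ε / 2)) := by
        gcongr
    _ = _ := by ring
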